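/- Let a < b be real numbers, 0 < ε < 1/2, and P := [0,ε] ∪ [1−ε,1]. Let h : [a,b]×[0,1] → ℂ, (t,r) ↦ h_t(r), be a smooth family such that for each t ∈ [a,b] the map h_t is an immersion whose slope h_t'/|h_t'| is not constant on [ε,1−ε]. Let ḡ : [a,b]×P → ℂ, (t,r) ↦ ḡ_t(r), be a smooth family such that (h_t, ḡ_t) satisfies the stabilization conditions on P for all t ∈ [a,b]. Then there exists a smooth family g : [a,b]×[0,1] → ℂ, (t,r) ↦ g_t(r), such that g_t = ḡ_t on P and (h_t, g_t) satisfies the stabilization conditions on [0,1] for all t ∈ [a,b]. -/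

import Mathlib

/-- The real inner product `⟨z,w⟩ = Re (z · conj w)` on `ℂ ≅ ℝ²`. -/
noncomputable def rinner (z w : ℂ) : ℝ := (z * (starRingEnd ℂ) w).re

/-- The pair `(h,g)` satisfies the stabilization conditions on `S`:
`⟨g'(r), i·h'(r)⟩ = 0` and `⟨g(r), i·h'(r)⟩ > 0` for all `r ∈ S`. -/
def StabOn (h g : ℝ → ℂ) (S : Set ℝ) : Prop :=
  ∀ r ∈ S, rinner (deriv g r) (Complex.I * deriv h r) = 0 ∧
    0 < rinner (g r) (Complex.I * deriv h r)

open Set MeasureTheory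
open scoped ContDiff Topology

theorem ContDiff.partial_deriv_snd {F : Type*} [NormedAddCommGroup F] [NormedSpace ℝ F]
    {f : ℝ × ℝ → F} (hf : ContDiff ℝ ∞ f) :
    ContDiff ℝ ∞ (fun p : ℝ × ℝ => deriv (fun r => f (p.1, r)) p.2) := by
  have key : ∀ p : ℝ × ℝ, deriv (fun r => f (p.1, r)) p.2 = fderiv ℝ f p (0, 1) := by
    intro p
    have h1 : HasFDerivAt f (fderiv ℝ f p) (p.1, p.2) :=
      (hf.differentiable (by simp) p).hasFDerivAt
    exact (h1.comp_hasDerivAt p.2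
      ((hasDerivAt_const p.2 p.1).prodMk (hasDerivAt_id p.2))).deriv
  simp_rw [key]
  exact (hf.fderiv_right (m := ∞) (by simp)).clm_apply contDiff_const

theorem ContDiff.hasDerivAt_slice {F : Type*} [NormedAddCommGroup F] [NormedSpace ℝ F]
    {f : ℝ × ℝ → F} (hf : ContDiff ℝ ∞ f) (t r : ℝ) :
    HasDerivAt (fun r => f (t, r)) (deriv (fun r => f (t, r)) r) r := by
  have : ContDiff ℝ ∞ fun r => f (t, r) := by fun_prop
  exact (this.differentiable (by simp) r).hasDerivAt

/-- A smooth function positive on a compact set agrees there with a smooth function that is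
positive everywhere. -/
theorem ContDiff.exists_pos_eqOn {E : Type*} [NormedAddCommGroup E] [NormedSpace ℝ E]
    {f : E → ℝ} (hf : ContDiff ℝ ∞ f) {K : Set E} (hK : IsCompact K) (hpos : ∀ x ∈ K, 0 < f x) :
    ∃ F : E → ℝ, ContDiff ℝ ∞ F ∧ (∀ x, 0 < F x) ∧ EqOn F f K := by
  obtain ⟨δ, hδ, hle⟩ : ∃ δ : ℝ, 0 < δ ∧ ∀ x ∈ K, δ ≤ f x := by
    rcases K.eq_empty_or_nonempty with rfl | hne
    · exact ⟨1, one_pos, by simp⟩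
    · obtain ⟨x, hx, hmin⟩ := hK.exists_isMinOn hne hf.continuous.continuousOn
      exact ⟨f x, hpos x hx, fun y hy => hmin hy⟩
  let σ : E → ℝ := fun x => Real.smoothTransition (2 / δ * f x - 1)
  have hσ : ContDiff ℝ ∞ σ := Real.smoothTransition.contDiff.comp (by fun_prop)
  refine ⟨fun x => σ x * f x + (1 - σ x) * δ, by fun_prop, fun x => ?_, fun x hx => ?_⟩
  · have h1 : σ x ≤ 1 := Real.smoothTransition.le_one _
    have h0 : 0 ≤ σ x := Real.smoothTransition.nonneg _
    rcases le_or_gt (f x) (δ / 2) with h | h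
    · have : σ x = 0 := Real.smoothTransition.zero_of_nonpos (by
        rw [div_mul_eq_mul_div, sub_nonpos, div_le_one hδ]; linarith)
      simp [this, hδ]
    · nlinarith [mul_nonneg h0 (sub_pos.2 h).le]
  · have : σ x = 1 := Real.smoothTransition.one_of_one_le (by
      have := hle x hx
      rw [div_mul_eq_mul_div, le_sub_iff_add_le, le_div_iff₀ hδ]; linarith)
    simp [this]

theorem contDiff_intervalIntegral_param_nat {E : Type} [NormedAddCommGroup E] [NormedSpace ℝ E]
    [ProperSpace E] (a b : ℝ) (n : ℕ) :
    ∀ {G : Type} [NormedAddCommGroup G] [NormedSpace ℝ G] [CompleteSpace G] {f : E × ℝ → G},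
      ContDiff ℝ ∞ f → ContDiff ℝ n (fun x => ∫ u in a..b, f (x, u)) := by
  induction n with
  | zero =>
    intro G _ _ _ f hf
    rw [Nat.cast_zero, contDiff_zero]
    exact intervalIntegral.continuous_parametric_intervalIntegral_of_continuous'
      (f := fun x u => f (x, u)) hf.continuous a b
  | succ n ih =>
    intro G _ _ _ f hf
    let f' : E × ℝ → E →L[ℝ] G := fun p => (fderiv ℝ f p).comp (ContinuousLinearMap.inl ℝ E ℝ)
    have hf' : ContDiff ℝ ∞ f' :=
      (hf.fderiv_right (m := ∞) (by simp)).clm_comp contDiff_const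
    push_cast
    refine contDiff_succ_iff_hasFDerivAt.2 ⟨fun x => ∫ u in a..b, f' (x, u), ih hf', fun x => ?_⟩
    have hK : IsCompact (Metric.closedBall x 1 ×ˢ uIcc a b) :=
      (isCompact_closedBall x 1).prod isCompact_uIcc
    obtain ⟨C, hC⟩ := hK.exists_bound_of_continuousOn hf'.continuous.continuousOn
    have hc : ∀ y, Continuous fun u => f (y, u) := fun y => hf.continuous.comp (by fun_prop)
    have hc' : Continuous fun u => f' (x, u) := hf'.continuous.comp (by fun_prop)
    refine intervalIntegral.hasFDerivAt_integral_of_dominated_of_fderiv_le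
      (F := fun y u => f (y, u)) (F' := fun y u => f' (y, u)) (bound := fun _ => C)
      (Metric.closedBall_mem_nhds x one_pos)
      (.of_forall fun y => (hc y).aestronglyMeasurable) ((hc x).intervalIntegrable _ _)
      hc'.aestronglyMeasurable (.of_forall fun u hu y hy => ?_) (by simp)
      (.of_forall fun u hu y hy => ?_)
    · exact hC _ ⟨hy, uIoc_subset_uIcc hu⟩
    · have h1 : HasFDerivAt f (fderiv ℝ f (y, u)) (y, u) :=
        (hf.differentiable (by simp) _).hasFDerivAt
      exact h1.comp y (hasFDerivAt_prodMk_left y u)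

theorem ContDiff.intervalIntegral_param {E G : Type} [NormedAddCommGroup E] [NormedSpace ℝ E]
    [ProperSpace E] [NormedAddCommGroup G] [NormedSpace ℝ G] [CompleteSpace G]
    {f : E × ℝ → G} (hf : ContDiff ℝ ∞ f) (a b : ℝ) :
    ContDiff ℝ ∞ (fun x => ∫ u in a..b, f (x, u)) :=
  contDiff_infty.2 fun n => contDiff_intervalIntegral_param_nat a b n hf

theorem ContDiff.primitive_snd {f : ℝ × ℝ → ℝ} (hf : ContDiff ℝ ∞ f) (c : ℝ) :
    ContDiff ℝ ∞ (fun p : ℝ × ℝ => ∫ x in c..p.2, f (p.1, x)) := by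
  have key : ∀ p : ℝ × ℝ, ∫ x in c..p.2, f (p.1, x) =
      (p.2 - c) * ∫ u in (0 : ℝ)..1, f (p.1, (p.2 - c) * u + c) := by
    intro p
    have := intervalIntegral.smul_integral_comp_mul_add (a := 0) (b := 1)
      (fun x => f (p.1, x)) (p.2 - c) c
    simp only [smul_eq_mul] at this
    rw [this]
    simp
  simp_rw [key]
  have h1 : ContDiff ℝ ∞ fun q : (ℝ × ℝ) × ℝ => f (q.1.1, (q.1.2 - c) * q.2 + c) :=
    hf.comp (by fun_prop)
  exact (contDiff_snd.sub contDiff_const).mul (h1.intervalIntegral_param 0 1)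

/-- The linear equation `∂L/∂r = -(α + s β)` with a smooth control `s`: prescribing `s` outside
`(c, d)`, the values of `L` at both ends can be prescribed as long as `β (t, ·)` does not vanish
identically. -/
theorem exists_control {a b c d : ℝ} (hcd : c < d) {α β sbar : ℝ × ℝ → ℝ} {l₀ l₁ : ℝ → ℝ}
    (hα : ContDiff ℝ ∞ α) (hβ : ContDiff ℝ ∞ β) (hs : ContDiff ℝ ∞ sbar)
    (hl₀ : ContDiff ℝ ∞ l₀) (hl₁ : ContDiff ℝ ∞ l₁)
    (hne : ∀ t ∈ Icc a b, ∃ r ∈ Ioo c d, β (t, r) ≠ 0) :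
    ∃ s L : ℝ × ℝ → ℝ, ContDiff ℝ ∞ s ∧ ContDiff ℝ ∞ L ∧
      (∀ t, ∀ r ∉ Ioo c d, s (t, r) = sbar (t, r)) ∧
      (∀ t r, HasDerivAt (fun r => L (t, r)) (-(α (t, r) + s (t, r) * β (t, r))) r) ∧
      ∀ t ∈ Icc a b, L (t, c) = l₀ t ∧ L (t, d) = l₁ t := by
  let χ : ℝ × ℝ → ℝ := fun p => expNegInvGlue (p.2 - c) * expNegInvGlue (d - p.2)
  have hχ : ContDiff ℝ ∞ χ := by
    have := expNegInvGlue.contDiff (n := ⊤)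
    exact (this.comp (by fun_prop)).mul (this.comp (by fun_prop))
  let D : ℝ → ℝ := fun t => ∫ x in c..d, χ (t, x) * β (t, x) ^ 2
  have hD : ContDiff ℝ ∞ D := (hχ.mul (hβ.pow 2)).intervalIntegral_param c d
  have hDpos : ∀ t ∈ Icc a b, 0 < D t := by
    intro t ht
    obtain ⟨r, hr, hr0⟩ := hne t ht
    refine intervalIntegral.integral_pos hcd ?_ (fun x _ => ?_) ⟨r, Ioo_subset_Icc_self hr, ?_⟩
    · exact Continuous.continuousOn
        ((hχ.mul (hβ.pow 2)).continuous.comp (Continuous.prodMk_right t))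
    · exact mul_nonneg (mul_nonneg (expNegInvGlue.nonneg _) (expNegInvGlue.nonneg _))
        (sq_nonneg _)
    · exact mul_pos (mul_pos (expNegInvGlue.pos_of_pos (sub_pos.2 hr.1))
        (expNegInvGlue.pos_of_pos (sub_pos.2 hr.2))) (by positivity)
  obtain ⟨M, hM, hMpos, hMD⟩ := hD.exists_pos_eqOn isCompact_Icc hDpos
  let J : ℝ → ℝ := fun t => ∫ x in c..d, (α (t, x) + sbar (t, x) * β (t, x))
  have hJ : ContDiff ℝ ∞ J := (hα.add (hs.mul hβ)).intervalIntegral_param c d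
  let k : ℝ → ℝ := fun t => (l₀ t - l₁ t - J t) / M t
  have hk : ContDiff ℝ ∞ k := ((hl₀.sub hl₁).sub hJ).div hM fun t => (hMpos t).ne'
  let s : ℝ × ℝ → ℝ := fun p => sbar p + k p.1 * (χ p * β p)
  have hs' : ContDiff ℝ ∞ s := hs.add ((hk.comp contDiff_fst).mul (hχ.mul hβ))
  have hf : ContDiff ℝ ∞ fun p => α p + s p * β p := hα.add (hs'.mul hβ)
  refine ⟨s, fun p => l₀ p.1 - ∫ x in c..p.2, (α (p.1, x) + s (p.1, x) * β (p.1, x)), hs',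
    (hl₀.comp contDiff_fst).sub (hf.primitive_snd c), fun t r hr => ?_, fun t r => ?_,
    fun t ht => ⟨by simp, ?_⟩⟩
  · have : χ (t, r) = 0 := by
      rw [mem_Ioo, not_and_or, not_lt, not_lt] at hr
      rcases hr with hr | hr
      · simp [χ, expNegInvGlue.zero_of_nonpos (sub_nonpos.2 hr)]
      · simp [χ, expNegInvGlue.zero_of_nonpos (sub_nonpos.2 hr)]
    simp [s, this]
  · have hcont : Continuous fun x => α (t, x) + s (t, x) * β (t, x) :=
      hf.continuous.comp (Continuous.prodMk_right t)
    exact (hcont.integral_hasStrictDerivAt c r).hasDerivAt.const_sub (l₀ t)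
  · have hint : ∀ {f : ℝ × ℝ → ℝ}, ContDiff ℝ ∞ f →
        IntervalIntegrable (fun x => f (t, x)) volume c d := fun hf =>
      (hf.continuous.comp (Continuous.prodMk_right t)).intervalIntegrable _ _
    have : ∫ x in c..d, (α (t, x) + s (t, x) * β (t, x)) = J t + k t * D t := by
      rw [← intervalIntegral.integral_const_mul, ← intervalIntegral.integral_add
        (hint (hα.add (hs.mul hβ))) ((hint (hχ.mul (hβ.pow 2))).const_mul _)]
      congr 1 with x
      simp only [s]
      ring
    simp only [this, ← hMD ht, k, div_mul_cancel₀ _ (hMpos t).ne']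
    ring

theorem rinner_I_mul (z w : ℂ) : rinner z (Complex.I * w) = z.im * w.re - z.re * w.im := by
  simp [rinner]

theorem ContDiff.complex_re {E : Type*} [NormedAddCommGroup E] [NormedSpace ℝ E] {f : E → ℂ}
    (hf : ContDiff ℝ ∞ f) : ContDiff ℝ ∞ fun x => (f x).re :=
  Complex.reCLM.contDiff.comp hf

theorem ContDiff.complex_im {E : Type*} [NormedAddCommGroup E] [NormedSpace ℝ E] {f : E → ℂ}
    (hf : ContDiff ℝ ∞ f) : ContDiff ℝ ∞ fun x => (f x).im :=
  Complex.imCLM.contDiff.comp hf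

theorem HasDerivAt.complex_re {f : ℝ → ℂ} {f' : ℂ} {x : ℝ} (hf : HasDerivAt f f' x) :
    HasDerivAt (fun x => (f x).re) f'.re x :=
  Complex.reCLM.hasFDerivAt.comp_hasDerivAt x hf

theorem HasDerivAt.complex_im {f : ℝ → ℂ} {f' : ℂ} {x : ℝ} (hf : HasDerivAt f f' x) :
    HasDerivAt (fun x => (f x).im) f'.im x :=
  Complex.imCLM.hasFDerivAt.comp_hasDerivAt x hf

theorem eqOn_zero_of_hasDerivAt_zero {f : ℝ → ℝ} {a b x₀ : ℝ}
    (hf : ∀ x ∈ Icc a b, HasDerivAt f 0 x) (hx₀ : x₀ ∈ Icc a b) (h0 : f x₀ = 0) :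
    ∀ x ∈ Icc a b, f x = 0 := by
  have key := constant_of_has_deriv_right_zero
    (fun x hx => (hf x hx).continuousAt.continuousWithinAt)
    (fun x hx => (hf x (Ico_subset_Icc_self hx)).hasDerivWithinAt)
  intro x hx
  rw [key x hx, ← key x₀ hx₀, h0]

/-- A curve in `ℂ \ {0}` whose velocity is always a real multiple of its position has constant
argument. -/
theorem div_norm_eq_of_velocity_parallel {v w : ℝ → ℂ} {a b : ℝ}
    (hv : ∀ x ∈ Icc a b, HasDerivAt v (w x) x) (hv0 : ∀ x ∈ Icc a b, v x ≠ 0)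
    (hpar : ∀ x ∈ Icc a b, (w x).im * (v x).re - (w x).re * (v x).im = 0)
    {x y : ℝ} (hx : x ∈ Icc a b) (hy : y ∈ Icc a b) :
    v x / (‖v x‖ : ℂ) = v y / (‖v y‖ : ℂ) := by
  have hder : ∀ x ∈ Icc a b, HasDerivAt (fun x => v x / (‖v x‖ : ℂ)) 0 x := by
    intro x hx
    have hn0 : 0 < ‖v x‖ := norm_pos_iff.2 (hv0 x hx)
    have hn := (hv x hx).norm_sq.sqrt (by positivity)
    simp only [Real.sqrt_sq (norm_nonneg _)] at hn
    have hsq : ‖v x‖ ^ 2 = (v x).re ^ 2 + (v x).im ^ 2 := by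
      rw [← Complex.normSq_eq_norm_sq, Complex.normSq_apply]
      ring
    have hc : (‖v x‖ : ℂ) ≠ 0 := by exact_mod_cast hn0.ne'
    have hinner : inner ℝ (v x) (w x) = (v x).re * (w x).re + (v x).im * (w x).im := by
      rw [Complex.inner]
      simp
      ring
    have hmul : w x * (‖v x‖ : ℂ) ^ 2 = v x * (inner ℝ (v x) (w x) : ℝ) := by
      rw [← Complex.ofReal_pow, hsq, hinner]
      have := hpar x hx
      apply Complex.ext
      · simp only [Complex.re_mul_ofReal]
        linear_combination -(v x).im * this
      · simp only [Complex.im_mul_ofReal]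
        linear_combination (v x).re * this
    refine ((hv x hx).div hn.ofReal_comp hc).congr_deriv ?_
    rw [div_eq_zero_iff]
    left
    push_cast
    field_simp
    linear_combination hmul
  have key := constant_of_has_deriv_right_zero
    (fun x hx => (hder x hx).continuousAt.continuousWithinAt)
    (fun x hx => (hder x (Ico_subset_Icc_self hx)).hasDerivWithinAt)
  exact (key x hx).trans (key y hy).symm

/-- parametric stabilization: a smooth family of immersions
`h_t` with nonconstant slope on `[ε,1−ε]`, together with a smooth family of
boundary stabilizing data `ḡ_t` on `P = [0,ε] ∪ [1−ε,1]`, admits a smooth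
family of stabilizing maps `g_t` on `[0,1]` agreeing with `ḡ_t` on `P`. -/
theorem stmt10 (a b : ℝ) (hab : a < b) (ε : ℝ) (hε0 : 0 < ε) (hε : ε < 1/2)
    (h gbar : ℝ → ℝ → ℂ)
    (h_sm : ContDiff ℝ (⊤ : ℕ∞) (Function.uncurry h))
    (gbar_sm : ContDiff ℝ (⊤ : ℕ∞) (Function.uncurry gbar))
    (himm : ∀ t ∈ Set.Icc a b, ∀ r ∈ Set.Icc (0:ℝ) 1, deriv (h t) r ≠ 0)
    (hnc : ∀ t ∈ Set.Icc a b, ∃ r₁ ∈ Set.Icc ε (1 - ε), ∃ r₂ ∈ Set.Icc ε (1 - ε),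
      deriv (h t) r₁ / (‖deriv (h t) r₁‖ : ℂ) ≠ deriv (h t) r₂ / (‖deriv (h t) r₂‖ : ℂ))
    (hstab : ∀ t ∈ Set.Icc a b,
      StabOn (h t) (gbar t) (Set.Icc 0 ε ∪ Set.Icc (1 - ε) 1)) :
    ∃ g : ℝ → ℝ → ℂ, ContDiff ℝ (⊤ : ℕ∞) (Function.uncurry g) ∧
      ∀ t ∈ Set.Icc a b,
        Set.EqOn (g t) (gbar t) (Set.Icc 0 ε ∪ Set.Icc (1 - ε) 1) ∧
        StabOn (h t) (g t) (Set.Icc 0 1) := by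
  let v : ℝ × ℝ → ℂ := fun p => deriv (h p.1) p.2
  have hv : ContDiff ℝ ∞ v := h_sm.partial_deriv_snd
  let w : ℝ × ℝ → ℂ := fun p => deriv (fun r => v (p.1, r)) p.2
  have hw : ContDiff ℝ ∞ w := hv.partial_deriv_snd
  have hvw : ∀ t r, HasDerivAt (fun r => v (t, r)) (w (t, r)) r := hv.hasDerivAt_slice
  have hgder : ∀ t r, HasDerivAt (gbar t) (deriv (gbar t) r) r := gbar_sm.hasDerivAt_slice
  have hvre := hv.complex_re
  have hvim := hv.complex_im
  have hwre := hw.complex_re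
  have hwim := hw.complex_im
  have hgre := gbar_sm.complex_re
  have hgim := gbar_sm.complex_im
  let n : ℝ × ℝ → ℝ := fun p => (v p).re ^ 2 + (v p).im ^ 2
  have hn : ContDiff ℝ ∞ n := (hvre.pow 2).add (hvim.pow 2)
  let A : ℝ × ℝ → ℝ := fun p => (w p).re * (v p).re + (w p).im * (v p).im
  have hA : ContDiff ℝ ∞ A := (hwre.mul hvre).add (hwim.mul hvim)
  let B : ℝ × ℝ → ℝ := fun p => (w p).im * (v p).re - (w p).re * (v p).im
  have hB : ContDiff ℝ ∞ B := (hwim.mul hvre).sub (hwre.mul hvim)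
  let R : ℝ × ℝ → ℝ := fun p => (gbar p.1 p.2).re * (v p).re + (gbar p.1 p.2).im * (v p).im
  have hR : ContDiff ℝ ∞ R := (hgre.mul hvre).add (hgim.mul hvim)
  let m : ℝ × ℝ → ℝ := fun p => (gbar p.1 p.2).im * (v p).re - (gbar p.1 p.2).re * (v p).im
  have hm : ContDiff ℝ ∞ m := (hgim.mul hvre).sub (hgre.mul hvim)
  let P : Set ℝ := Icc 0 ε ∪ Icc (1 - ε) 1
  have hPsub : P ⊆ Icc 0 1 := by
    rintro r (hr | hr) <;> constructor <;> linarith [hr.1, hr.2]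
  have hPout : ∀ r ∈ P, r ∉ Ioo ε (1 - ε) := by
    rintro r (hr | hr) hr'
    · exact hr.2.not_gt hr'.1
    · exact hr.1.not_gt hr'.2
  have hnpos : ∀ p ∈ Icc a b ×ˢ Icc (0 : ℝ) 1, 0 < n p := by
    rintro ⟨t, r⟩ ⟨ht, hr⟩
    have := Complex.normSq_pos.2 (himm t ht r hr)
    rw [Complex.normSq_apply] at this
    change 0 < (deriv (h t) r).re ^ 2 + (deriv (h t) r).im ^ 2
    linarith
  have hmpos : ∀ p ∈ Icc a b ×ˢ P, 0 < m p := by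
    rintro ⟨t, r⟩ ⟨ht, hr⟩
    have := (hstab t ht r hr).2
    rwa [rinner_I_mul] at this
  obtain ⟨N, hN, hNpos, hNn⟩ := hn.exists_pos_eqOn (isCompact_Icc.prod isCompact_Icc) hnpos
  obtain ⟨M, hM, hMpos, hMm⟩ :=
    hm.exists_pos_eqOn (isCompact_Icc.prod (isCompact_Icc.union isCompact_Icc)) hmpos
  have hl : ∀ c : ℝ, ContDiff ℝ ∞ fun t => Real.log (M (t, c)) - Real.log (N (t, c)) := fun c =>
    ((hM.comp (by fun_prop)).log fun t => (hMpos _).ne').sub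
      ((hN.comp (by fun_prop)).log fun t => (hNpos _).ne')
  have hne : ∀ t ∈ Icc a b, ∃ r ∈ Ioo ε (1 - ε), B (t, r) / N (t, r) ≠ 0 := by
    intro t ht
    by_contra! hzero
    have hB0 : EqOn (fun r => B (t, r)) (fun _ => 0) (Icc ε (1 - ε)) := by
      rw [← closure_Ioo (by linarith : ε ≠ 1 - ε)]
      refine EqOn.closure (fun r hr => ?_)
        (hB.continuous.comp (Continuous.prodMk_right t)) continuous_const
      exact (div_eq_zero_iff.1 (hzero r hr)).resolve_right (hNpos _).ne'
    obtain ⟨r₁, hr₁, r₂, hr₂, hr⟩ := hnc t ht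
    exact hr (div_norm_eq_of_velocity_parallel (fun x _ => hvw t x)
      (fun x hx => himm t ht x ⟨by linarith [hx.1], by linarith [hx.2]⟩) hB0 hr₁ hr₂)
  obtain ⟨s, L, hs, hL, hsout, hLder, hLend⟩ := exists_control (by linarith : ε < 1 - ε)
    (α := fun p => A p / N p) (β := fun p => B p / N p) (sbar := fun p => R p / M p) (hA.div hN fun p => (hNpos p).ne') (hB.div hN fun p => (hNpos p).ne')
    (hR.div hM fun p => (hMpos p).ne') (hl ε) (hl (1 - ε)) hne
  let g : ℝ × ℝ → ℂ := fun p => v p * ((Real.exp (L p) : ℂ) * ((s p : ℂ) + Complex.I))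
  have hg : ContDiff ℝ ∞ g :=
    hv.mul ((Complex.ofRealCLM.contDiff.comp hL.exp).mul
      ((Complex.ofRealCLM.contDiff.comp hs).add contDiff_const))
  refine ⟨fun t r => g (t, r), hg, fun t ht => ⟨?_, ?_⟩⟩
  · let f : ℝ → ℝ := fun r => Real.log (m (t, r)) - Real.log (n (t, r)) - L (t, r)
    have hder : ∀ r ∈ P, HasDerivAt f 0 r := by
      intro r hr
      have hmp := hmpos (t, r) ⟨ht, hr⟩
      have hnp := hnpos (t, r) ⟨ht, hPsub hr⟩
      have hst := (hstab t ht r hr).1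
      rw [rinner_I_mul] at hst
      have dv := hvw t r
      have dg := hgder t r
      have dm : HasDerivAt (fun r => m (t, r)) _ r :=
        (dg.complex_im.mul dv.complex_re).sub (dg.complex_re.mul dv.complex_im)
      have dn : HasDerivAt (fun r => n (t, r)) _ r :=
        (dv.complex_re.pow 2).add (dv.complex_im.pow 2)
      refine (((dm.log hmp.ne').sub (dn.log hnp.ne')).sub (hLder t r)).congr_deriv ?_
      rw [hsout t r (hPout r hr), hMm (mk_mem_prod ht hr), hNn (mk_mem_prod ht (hPsub hr))]
      change 0 < (gbar t r).im * (v (t, r)).re - (gbar t r).re * (v (t, r)).im at hmp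
      change 0 < (v (t, r)).re ^ 2 + (v (t, r)).im ^ 2 at hnp
      change (deriv (gbar t) r).im * (v (t, r)).re - (deriv (gbar t) r).re * (v (t, r)).im = 0
        at hst
      have aux : ∀ {x y m n A B R : ℝ}, m ≠ 0 → n ≠ 0 → x * n - y * m + A * m + R * B = 0 →
          x / m - y / n - -(A / n + R / m * (B / n)) = 0 := by
        intro x y m n A B R hm hn h
        field_simp
        linear_combination h
      refine aux hmp.ne' hnp.ne' ?_
      simp only [A, B, R]
      push_cast
      linear_combination ((v (t, r)).re ^ 2 + (v (t, r)).im ^ 2) * hst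
    have hend : ∀ c ∈ P, L (t, c) = Real.log (M (t, c)) - Real.log (N (t, c)) → f c = 0 := by
      intro c hc h
      rw [hMm (mk_mem_prod ht hc), hNn (mk_mem_prod ht (hPsub hc))] at h
      simp [f, h]
    have hεP : ε ∈ P := Or.inl ⟨hε0.le, le_rfl⟩
    have hεP' : 1 - ε ∈ P := Or.inr ⟨le_rfl, by linarith⟩
    have hf : ∀ r ∈ P, f r = 0 := by
      rintro r (hr | hr)
      · exact eqOn_zero_of_hasDerivAt_zero (fun x hx => hder x (Or.inl hx)) ⟨hε0.le, le_rfl⟩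
          (hend ε hεP (hLend t ht).1) r hr
      · exact eqOn_zero_of_hasDerivAt_zero (fun x hx => hder x (Or.inr hx))
          ⟨le_rfl, by linarith⟩ (hend (1 - ε) hεP' (hLend t ht).2) r hr
    intro r hr
    have hmp := hmpos (t, r) ⟨ht, hr⟩
    have hnp := hnpos (t, r) ⟨ht, hPsub hr⟩
    have hexp : Real.exp (L (t, r)) = m (t, r) / n (t, r) := by
      rw [← sub_eq_zero.1 (hf r hr), ← Real.log_div hmp.ne' hnp.ne', Real.exp_log (by positivity)]
    simp only [g]
    rw [hexp, hsout t r (hPout r hr), hMm (mk_mem_prod ht hr)]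
    have hm0 := hmp.ne'
    have hn0 := hnp.ne'
    have h1 : m (t, r) / n (t, r) * (R (t, r) / m (t, r)) = R (t, r) / n (t, r) := by
      field_simp
    rw [mul_add, ← Complex.ofReal_mul, h1]
    change (v (t, r)).re ^ 2 + (v (t, r)).im ^ 2 ≠ 0 at hn0
    apply Complex.ext <;>
    · simp only [Complex.mul_re, Complex.mul_im, Complex.add_re, Complex.add_im,
        Complex.ofReal_re, Complex.ofReal_im, Complex.I_re, Complex.I_im, m, n, R]
      field_simp
      ring
  · intro r hr
    have hnp := hnpos (t, r) ⟨ht, hr⟩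
    have hgr : HasDerivAt (fun r => g (t, r)) _ r :=
      (hvw t r).mul ((hLder t r).exp.ofReal_comp.mul
        ((hs.hasDerivAt_slice t r).ofReal_comp.add_const Complex.I))
    rw [rinner_I_mul, rinner_I_mul, hgr.deriv, hNn (mk_mem_prod ht hr)]
    change 0 < (v (t, r)).re ^ 2 + (v (t, r)).im ^ 2 at hnp
    have hn0 := hnp.ne'
    change _ * (v (t, r)).re - _ * (v (t, r)).im = 0 ∧
      0 < (g (t, r)).im * (v (t, r)).re - (g (t, r)).re * (v (t, r)).im
    constructor
    · simp only [Complex.mul_re, Complex.mul_im, Complex.add_re, Complex.add_im,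
        Complex.ofReal_re, Complex.ofReal_im, Complex.I_re, Complex.I_im, n, A, B]
      field_simp
      ring
    · have : (g (t, r)).im * (v (t, r)).re - (g (t, r)).re * (v (t, r)).im =
          Real.exp (L (t, r)) * ((v (t, r)).re ^ 2 + (v (t, r)).im ^ 2) := by
        simp only [Complex.mul_re, Complex.mul_im, Complex.add_re, Complex.add_im,
          Complex.ofReal_re, Complex.ofReal_im, Complex.I_re, Complex.I_im, g]
        ring
      rw [this]
      positivity
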